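/- Let φ : (Kⁿ,‖·‖₁) → (Kⁿ,‖·‖₁) be a bijective isometry with φ(0) = 0. Then there exist a permutation σ of {1,…,n} and bijective isometries τ₁,…,τₙ : K → K of (K, |·|) with τᵢ(0) = 0 for every i, such that φ(a₁,…,aₙ) = (τ₁(a_{σ(1)}),…,τₙ(a_{σ(n)})) for all (a₁,…,aₙ) ∈ Kⁿ. -/

import Mathlib

theorem l1_between_iff {K : Type*} [Field K] (v : K → ℝ)
    (hnonneg : ∀ a : K, 0 ≤ v a)
    (hzero : ∀ a : K, v a = 0 ↔ a = 0)
    (hultra : ∀ a b : K, v (a + b) ≤ max (v a) (v b))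
    (n : ℕ) (x z y : Fin n → K) :
    (∑ i, v (x i - z i) + ∑ i, v (z i - y i) = ∑ i, v (x i - y i)) ↔
      ∀ i, z i = x i ∨ z i = y i := by
  have hu : ∀ i, v (x i - y i) ≤ max (v (x i - z i)) (v (z i - y i)) := by
    intro i
    have := hultra (x i - z i) (z i - y i)
    rwa [sub_add_sub_cancel] at this
  have hle : ∀ i ∈ Finset.univ, v (x i - y i) ≤ v (x i - z i) + v (z i - y i) := by
    intro i _
    refine (hu i).trans (max_le ?_ ?_)
    · linarith [hnonneg (z i - y i)]
    · linarith [hnonneg (x i - z i)]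
  rw [← Finset.sum_add_distrib, eq_comm, Finset.sum_eq_sum_iff_of_le hle]
  have v0 : v 0 = 0 := (hzero 0).2 rfl
  constructor
  · intro h i
    have h1 := h i (Finset.mem_univ i)
    have h2 := hu i
    rcases le_max_iff.1 h2 with h3 | h3
    · right
      have : v (z i - y i) = 0 := le_antisymm (by linarith) (hnonneg _)
      exact sub_eq_zero.1 ((hzero _).1 this)
    · left
      have : v (x i - z i) = 0 := le_antisymm (by linarith) (hnonneg _)
      exact (sub_eq_zero.1 ((hzero _).1 this)).symm
  · intro h i _
    rcases h i with h | h <;> simp [h, v0]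

/-- combinatorial part -/
theorem adj_pres {K : Type*} [Field K] {n : ℕ} (φ : (Fin n → K) → (Fin n → K))
    (hbij : Function.Bijective φ)
    (hB : ∀ x z y : Fin n → K, (∀ i, z i = x i ∨ z i = y i) ↔
      ∀ i, φ z i = φ x i ∨ φ z i = φ y i) (x y : Fin n → K) :
    (∃ i, ∀ j, j ≠ i → x j = y j) → φ x = φ y ∨ (∃ i, ∀ j, j ≠ i → φ x j = φ y j) := by
  rintro ⟨i, hi⟩
  by_cases hxy : φ x = φ y
  · exact Or.inl hxy
  right
  obtain ⟨k, hk⟩ := Function.ne_iff.1 hxy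
  obtain ⟨z, hz⟩ := hbij.2 (Function.update (φ x) k (φ y k))
  have hb : ∀ i, z i = x i ∨ z i = y i := by
    rw [hB, hz]
    intro j
    by_cases hj : j = k
    · subst hj; simp
    · simp [hj]
  have hzz : z = x ∨ z = y := by
    rcases hb i with h | h
    · left; ext j
      by_cases hj : j = i
      · rw [hj, h]
      · have := hi j hj; have := hb j; grind
    · right; ext j
      by_cases hj : j = i
      · rw [hj, h]
      · have := hi j hj; have := hb j; grind
  refine ⟨k, fun j hj => ?_⟩
  rcases hzz with h | h
  · exfalso
    rw [h] at hz
    have := congrFun hz k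
    simp at this
    exact hk this
  · rw [h] at hz
    have := congrFun hz j
    simp [hj] at this
    exact this.symm

theorem supp_single {K : Type*} [Field K] {n : ℕ} (φ : (Fin n → K) → (Fin n → K))
    (hbij : Function.Bijective φ)
    (hB : ∀ x z y : Fin n → K, (∀ i, z i = x i ∨ z i = y i) ↔
      ∀ i, φ z i = φ x i ∨ φ z i = φ y i) (h0 : φ 0 = 0) (i : Fin n) :
    ∃ k, ∀ a, ∀ j, j ≠ k → φ (Pi.single i a) j = 0 := by
  have hadj := adj_pres φ hbij hB
  have hs : ∀ a b : K, ∃ k, ∀ j, j ≠ k → φ (Pi.single i a) j = φ (Pi.single i b) j := by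
    intro a b
    rcases hadj (Pi.single i a) (Pi.single i b) ⟨i, fun j hj => by simp [hj]⟩ with h | h
    · exact ⟨i, fun j _ => by rw [h]⟩
    · exact h
  have hs0 : ∀ a : K, ∃ k, ∀ j, j ≠ k → φ (Pi.single i a) j = 0 := by
    intro a
    obtain ⟨k, hk⟩ := hs a 0
    exact ⟨k, fun j hj => by rw [hk j hj]; simp [h0]⟩
  have hne : ∀ a : K, a ≠ 0 → ∃ k, φ (Pi.single i a) k ≠ 0 := by
    intro a ha
    by_contra! hc
    have : φ (Pi.single i a) = φ 0 := by rw [h0]; ext j; exact hc j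
    have := congrFun (hbij.1 this) i
    simp at this
    exact ha this
  obtain ⟨k, hk⟩ := hs0 1
  refine ⟨k, fun a j hj => ?_⟩
  by_contra hc
  obtain ⟨l, hl⟩ := hs0 a
  obtain ⟨m, hm⟩ := hs a 1
  obtain ⟨p, hp⟩ := hne 1 one_ne_zero
  have e1 : p = k := by by_contra h; exact hp (hk p h)
  have e2 : j = l := by by_contra h; exact hc (hl j h)
  have e3 : j = m := by by_contra h; exact hc ((hm j h).trans (hk j hj))
  have e4 : p = m := by
    by_contra h
    have := hm p h
    rw [hl p (by rw [e1, ← e2]; exact Ne.symm hj)] at this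
    exact hp this.symm
  exact hj (by rw [e3, ← e4, e1])


/-- hard direction of Theorem `Kn1`: every centred bijective
isometry of `(Kⁿ, ‖·‖₁)` has the form
`φ(a₁,…,aₙ) = (τ₁(a_{σ 1}), …, τₙ(a_{σ n}))` for some permutation `σ` and
centred bijective isometries `τ₁, …, τₙ` of `K`. -/
theorem stmt_7 {K : Type*} [Field K] (v : K → ℝ)
    (hnonneg : ∀ a : K, 0 ≤ v a)
    (hzero : ∀ a : K, v a = 0 ↔ a = 0)
    (hmul : ∀ a b : K, v (a * b) = v a * v b)
    (hultra : ∀ a b : K, v (a + b) ≤ max (v a) (v b))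
    (n : ℕ) (φ : (Fin n → K) → (Fin n → K)) (hbij : Function.Bijective φ)
    (hiso : ∀ x y : Fin n → K, ∑ i, v (φ x i - φ y i) = ∑ i, v (x i - y i))
    (h0 : φ 0 = 0) :
    ∃ (σ : Equiv.Perm (Fin n)) (τ : Fin n → K → K),
      (∀ i, Function.Bijective (τ i)) ∧
      (∀ i, ∀ a b : K, v (τ i a - τ i b) = v (a - b)) ∧
      (∀ i, τ i 0 = 0) ∧
      (∀ a : Fin n → K, ∀ i, φ a i = τ i (a (σ i))) := by

  have hB : ∀ x z y : Fin n → K, (∀ i, z i = x i ∨ z i = y i) ↔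
      ∀ i, φ z i = φ x i ∨ φ z i = φ y i := by
    intro x z y
    rw [← l1_between_iff v hnonneg hzero hultra, ← l1_between_iff v hnonneg hzero hultra, hiso, hiso, hiso]
  let e := Equiv.ofBijective φ hbij
  have he : ∀ x, φ (e.symm x) = x := fun x => e.apply_symm_apply x
  have hBs : ∀ x z y : Fin n → K, (∀ i, z i = x i ∨ z i = y i) ↔
      ∀ i, e.symm z i = e.symm x i ∨ e.symm z i = e.symm y i := by
    intro x z y
    rw [hB (e.symm x) (e.symm z) (e.symm y), he, he, he]
  have hs0 : e.symm 0 = 0 := hbij.1 (by rw [he, h0])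
  choose π hπ using supp_single φ hbij hB h0
  choose ρ hρ using supp_single e.symm e.symm.bijective hBs hs0
  have form : ∀ i a, φ (Pi.single i a) = Pi.single (π i) (φ (Pi.single i a) (π i)) := by
    intro i a
    ext j
    by_cases hj : j = π i
    · subst hj; simp
    · simp [hj, hπ i a j hj]
  have forms : ∀ i a, e.symm (Pi.single i a) = Pi.single (ρ i) (e.symm (Pi.single i a) (ρ i)) := by
    intro i a
    ext j
    by_cases hj : j = ρ i
    · subst hj; simp
    · simp [hj, hρ i a j hj]
  have hne : ∀ i a, a ≠ 0 → φ (Pi.single i a) (π i) ≠ 0 := by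
    intro i a ha hc
    have h1 := form i a
    rw [hc, Pi.single_zero, ← h0] at h1
    have := congrFun (hbij.1 h1) i
    simp at this
    exact ha this
  have hnes : ∀ i a, a ≠ 0 → e.symm (Pi.single i a) (ρ i) ≠ 0 := by
    intro i a ha hc
    have h1 := forms i a
    rw [hc, Pi.single_zero, ← hs0] at h1
    have := congrFun (e.symm.injective h1) i
    simp at this
    exact ha this
  have hπρ : ∀ k, π (ρ k) = k := by
    intro k
    by_contra hc
    have h1 := forms k 1
    have h2 := hnes k 1 one_ne_zero
    have h3 := hπ (ρ k) (e.symm (Pi.single k 1) (ρ k)) k (Ne.symm hc)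
    rw [← h1, he] at h3
    simp at h3
  have hρπ : ∀ k, ρ (π k) = k := by
    intro k
    have hsurj : Function.Surjective π := fun k => ⟨ρ k, hπρ k⟩
    have hinj := Finite.injective_iff_surjective.2 hsurj
    exact hinj (hπρ (π k))
  have key : ∀ (x : Fin n → K) (i : Fin n), φ x (π i) = φ (Pi.single i (x i)) (π i) := by
    intro x i
    by_cases hx : x i = 0
    · rw [hx, Pi.single_zero, h0]
      by_contra hc
      have hc' : φ x (π i) ≠ 0 := hc
      have hb : ∀ j, (Pi.single (π i) (φ x (π i)) : Fin n → K) j = (0 : Fin n → K) j ∨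
          (Pi.single (π i) (φ x (π i)) : Fin n → K) j = φ x j := by
        intro j
        by_cases hj : j = π i
        · subst hj; simp
        · simp [hj]
      have h1 := (hBs _ _ _).1 hb i
      have h2 := hnes (π i) _ hc'
      rw [hρπ] at h2
      have h3 : e.symm (φ x) = x := e.symm_apply_apply x
      rw [hs0, h3, hx] at h1
      simp at h1
      exact h2 h1
    · have hb : ∀ j, (Pi.single i (x i) : Fin n → K) j = (0 : Fin n → K) j ∨
          (Pi.single i (x i) : Fin n → K) j = x j := by
        intro j
        by_cases hj : j = i
        · subst hj; simp
        · simp [hj]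
      have h1 := (hB _ _ _).1 hb (π i)
      rw [h0] at h1
      rcases h1 with h1 | h1
      · exact absurd h1 (hne i _ hx)
      · exact h1.symm
  have v0 : v 0 = 0 := (hzero 0).2 rfl
  have main : ∀ (a : Fin n → K) (k : Fin n), φ a k = φ (Pi.single (ρ k) (a (ρ k))) k := by
    intro a k
    have := key a (ρ k)
    rwa [hπρ] at this
  have hisoτ : ∀ (k : Fin n) (a b : K),
      v (φ (Pi.single (ρ k) a) k - φ (Pi.single (ρ k) b) k) = v (a - b) := by
    intro k a b
    have h := hiso (Pi.single (ρ k) a) (Pi.single (ρ k) b)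
    rw [Finset.sum_eq_single k, Finset.sum_eq_single (ρ k)] at h
    · simpa using h
    · intro j _ hj; simp [hj, v0]
    · simp
    · intro j _ hj
      have hj' : j ≠ π (ρ k) := by rwa [hπρ]
      rw [hπ _ _ j hj', hπ _ _ j hj']; simp [v0]
    · simp
  refine ⟨⟨ρ, π, hπρ, hρπ⟩, fun k a => φ (Pi.single (ρ k) a) k, ?_, hisoτ, ?_, ?_⟩
  · intro k
    constructor
    · intro a b hab
      have h := hisoτ k a b
      have hab' : φ (Pi.single (ρ k) a) k = φ (Pi.single (ρ k) b) k := hab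
      rw [hab', sub_self, v0] at h
      exact sub_eq_zero.1 ((hzero _).1 h.symm)
    · intro c
      refine ⟨e.symm (Pi.single k c) (ρ k), ?_⟩
      have := main (e.symm (Pi.single k c)) k
      rw [he] at this
      simpa using this.symm
  · intro k; simp [h0]
  · intro a k; exact main a k
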